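/- Let D be an almost Dedekind domain. Then the following are equivalent: (i) Crit(D) = Max(D); (ii) Crit^n(D) = Max(D) for some n ∈ ℕ; (iii) Crit^n(D) = Max(D) for all n ∈ ℕ; (iv) Crit^ω(D) = Max(D); (v) no nonzero proper finitely generated ideal of D is bounded. -/

import Mathlib

/-!
Common definitions: almost Dedekind domains, ideal functions, critical ideals,
the constructible topology on the maximal spectrum.
-/

open scoped Classical Topology

namespace ADPaper

variable (R : Type*) [CommRing R]

/-- The normalized valuation `v_M(x)` of an element `x` of `R` in the localization at the
maximal ideal `M`: the largest `n` such that the image of `x` lies in the `n`-th power of the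
maximal ideal of `R_M` (a junk value if no largest such `n` exists). -/
noncomputable def elemVal (M : MaximalSpectrum R) (x : R) : ℕ :=
  sSup {n : ℕ | algebraMap R (Localization.AtPrime M.asIdeal) x ∈
    IsLocalRing.maximalIdeal (Localization.AtPrime M.asIdeal) ^ n}

/-- The ideal function `ν_I(M) = v_M(I) = min { v_M(x) : x ∈ I, x ≠ 0 }`. -/
noncomputable def nu (I : Ideal R) (M : MaximalSpectrum R) : ℕ :=
  sInf (elemVal R M '' {x | x ∈ I ∧ x ≠ 0})

/-- `R` is an almost Dedekind domain: the localization at every maximal ideal is a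
discrete valuation ring. (The requirement that `R` is not a field is stated separately
where needed.) -/
def AlmostDedekind [IsDomain R] : Prop :=
  ∀ M : MaximalSpectrum R, IsDiscreteValuationRing (Localization.AtPrime M.asIdeal)

/-- An ideal `M` of a commutative ring is critical if it is maximal and contains no nonzero
finitely generated radical ideal. -/
def IsCritical (M : Ideal R) : Prop :=
  M.IsMaximal ∧ ∀ J : Ideal R, J ≠ ⊥ → J.FG → J.IsRadical → ¬ J ≤ M

/-- `Crit R`: the set of critical maximal ideals, i.e. maximal ideals containing no
nonzero finitely generated radical ideal. -/
def Crit : Set (MaximalSpectrum R) :=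
  {M | ∀ J : Ideal R, J ≠ ⊥ → J.FG → J.IsRadical → ¬ J ≤ M.asIdeal}

/-- `CritN R n`: the set of `n`-critical maximal ideals, i.e. maximal ideals containing no
nonzero finitely generated ideal whose ideal function is bounded by `n`. -/
def CritN (n : ℕ) : Set (MaximalSpectrum R) :=
  {M | ∀ J : Ideal R, J ≠ ⊥ → J.FG → (∀ N, nu R J N ≤ n) → ¬ J ≤ M.asIdeal}

/-- `CritOmega R`: the set of `ω`-critical maximal ideals, i.e. maximal ideals containing no
nonzero finitely generated ideal whose ideal function is bounded. -/
def CritOmega : Set (MaximalSpectrum R) :=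
  {M | ∀ J : Ideal R, J ≠ ⊥ → J.FG → (∃ n : ℕ, ∀ N, nu R J N ≤ n) → ¬ J ≤ M.asIdeal}

/-- The constructible topology on the maximal spectrum: generated by the sets
`V(J) = {M | J ≤ M}` and their complements, for `J` finitely generated. -/
def constrTop : TopologicalSpace (MaximalSpectrum R) :=
  TopologicalSpace.generateFrom
    {S | ∃ J : Ideal R, J.FG ∧ (S = {M | J ≤ M.asIdeal} ∨ S = {M | ¬ J ≤ M.asIdeal})}

variable [IsDomain R]

/-- The localization `R_M` regarded as a subalgebra of the fraction field. -/
noncomputable def locSubalgebra (M : MaximalSpectrum R) : Subalgebra R (FractionRing R) :=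
  Localization.subalgebra (FractionRing R) M.asIdeal.primeCompl
    (fun _s hs => mem_nonZeroDivisors_of_ne_zero fun h => hs (h ▸ M.asIdeal.zero_mem))

/-- The overring `⋂ {R_M : M ∈ X}` of `R` inside the fraction field (equal to the whole
fraction field when `X = ∅`). -/
noncomputable def interLoc (X : Set (MaximalSpectrum R)) : Subalgebra R (FractionRing R) :=
  ⨅ M ∈ X, locSubalgebra R M

/-- The valuation `v_M` extended to the fraction field: `v_M(a/s) = v_M(a) - v_M(s)`. -/
noncomputable def elemValK (M : MaximalSpectrum R) (x : FractionRing R) : ℤ :=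
  (elemVal R M (IsLocalization.sec (nonZeroDivisors R) x).1 : ℤ) -
    (elemVal R M ((IsLocalization.sec (nonZeroDivisors R) x).2 : R) : ℤ)

/-- The ideal function of a fractional ideal. -/
noncomputable def nuK (I : FractionalIdeal (nonZeroDivisors R) (FractionRing R))
    (M : MaximalSpectrum R) : ℤ :=
  sInf (elemValK R M '' {x | x ∈ I ∧ x ≠ 0})

end ADPaper

namespace ADPaper

section Valuation

variable {R : Type*} [CommRing R]

lemma nu_le_elemVal {I : Ideal R} {x : R} (hxI : x ∈ I) (hx : x ≠ 0) (M : MaximalSpectrum R) :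
    nu R I M ≤ elemVal R M x :=
  Nat.sInf_le ⟨x, ⟨hxI, hx⟩, rfl⟩

lemma exists_elemVal_eq_nu {I : Ideal R} (hI : I ≠ ⊥) (M : MaximalSpectrum R) :
    ∃ x ∈ I, x ≠ 0 ∧ elemVal R M x = nu R I M := by
  obtain ⟨y, hy, hy0⟩ := Submodule.exists_mem_ne_zero_of_ne_bot hI
  obtain ⟨x, ⟨hx, hx0⟩, h⟩ :=
    Nat.sInf_mem (s := elemVal R M '' {x | x ∈ I ∧ x ≠ 0}) ⟨_, y, ⟨hy, hy0⟩, rfl⟩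
  exact ⟨x, hx, hx0, h⟩

variable [IsDomain R]

/-- Membership of a nonzero element in the powers of the localized maximal ideal is
governed by its valuation. -/
lemma AlmostDedekind.algebraMap_mem_pow_iff (hAD : AlmostDedekind R) (M : MaximalSpectrum R)
    {x : R} (hx : x ≠ 0) (n : ℕ) :
    algebraMap R (Localization.AtPrime M.asIdeal) x ∈
      IsLocalRing.maximalIdeal (Localization.AtPrime M.asIdeal) ^ n ↔ n ≤ elemVal R M x := by
  have := hAD M
  set m := IsLocalRing.maximalIdeal (Localization.AtPrime M.asIdeal)
  set y := algebraMap R (Localization.AtPrime M.asIdeal) x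
  have hy : y ≠ 0 := by
    rw [← map_zero (algebraMap R (Localization.AtPrime M.asIdeal))]
    exact (IsLocalization.injective (Localization.AtPrime M.asIdeal)
      M.asIdeal.primeCompl_le_nonZeroDivisors).ne hx
  obtain ⟨N, hN⟩ : ∃ N, y ∉ m ^ N := by
    by_contra! h
    have hbot := Ideal.iInf_pow_eq_bot_of_isLocalRing m (Ideal.IsPrime.ne_top inferInstance)
    exact hy ((Submodule.mem_bot _).1 (hbot ▸ (Submodule.mem_iInf _).2 h))
  have hbdd : BddAbove {k : ℕ | y ∈ m ^ k} :=
    ⟨N, fun k hk => by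
      by_contra! hlt
      exact hN (Ideal.pow_le_pow_right hlt.le hk)⟩
  refine ⟨fun h => le_csSup hbdd h, fun h => ?_⟩
  have hmem : sSup {k : ℕ | y ∈ m ^ k} ∈ {k : ℕ | y ∈ m ^ k} :=
    Nat.sSup_mem ⟨0, by simp⟩ hbdd
  exact Ideal.pow_le_pow_right h hmem

lemma AlmostDedekind.map_le_pow_iff (hAD : AlmostDedekind R) (M : MaximalSpectrum R)
    {I : Ideal R} (hI : I ≠ ⊥) (n : ℕ) :
    I.map (algebraMap R (Localization.AtPrime M.asIdeal)) ≤
      IsLocalRing.maximalIdeal (Localization.AtPrime M.asIdeal) ^ n ↔ n ≤ nu R I M := by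
  rw [Ideal.map_le_iff_le_comap]
  constructor
  · intro h
    obtain ⟨x, hx, hx0, he⟩ := exists_elemVal_eq_nu hI M
    exact he ▸ (hAD.algebraMap_mem_pow_iff M hx0 n).1 (h hx)
  · intro h x hx
    rcases eq_or_ne x 0 with rfl | hx0
    · simp
    · exact (hAD.algebraMap_mem_pow_iff M hx0 n).2 (h.trans (nu_le_elemVal hx hx0 M))

lemma AlmostDedekind.maximalIdeal_pow_le_iff (hAD : AlmostDedekind R) (M : MaximalSpectrum R)
    {a b : ℕ} :
    IsLocalRing.maximalIdeal (Localization.AtPrime M.asIdeal) ^ a ≤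
      IsLocalRing.maximalIdeal (Localization.AtPrime M.asIdeal) ^ b ↔ b ≤ a := by
  have := hAD M
  exact (Ideal.pow_right_strictAnti _ (IsDiscreteValuationRing.not_a_field _)
    (Ideal.IsPrime.ne_top inferInstance)).le_iff_ge

lemma map_atPrime_ne_bot (M : MaximalSpectrum R) {I : Ideal R} (hI : I ≠ ⊥) :
    I.map (algebraMap R (Localization.AtPrime M.asIdeal)) ≠ ⊥ := by
  rwa [Ne, Ideal.map_eq_bot_iff_of_injective (IsLocalization.injective _
    M.asIdeal.primeCompl_le_nonZeroDivisors)]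

lemma AlmostDedekind.map_eq_pow_nu (hAD : AlmostDedekind R) (M : MaximalSpectrum R)
    {I : Ideal R} (hI : I ≠ ⊥) :
    I.map (algebraMap R (Localization.AtPrime M.asIdeal)) =
      IsLocalRing.maximalIdeal (Localization.AtPrime M.asIdeal) ^ nu R I M := by
  have := hAD M
  obtain ⟨ϖ, hϖ⟩ := IsDiscreteValuationRing.exists_irreducible (Localization.AtPrime M.asIdeal)
  obtain ⟨e, he⟩ := IsDiscreteValuationRing.ideal_eq_span_pow_irreducible
    (map_atPrime_ne_bot M hI) hϖ
  rw [← Ideal.span_singleton_pow, ← hϖ.maximalIdeal_eq] at he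
  have h : ∀ n, n ≤ e ↔ n ≤ nu R I M := fun n => by
    rw [← hAD.map_le_pow_iff M hI, he, hAD.maximalIdeal_pow_le_iff]
  rw [he, le_antisymm ((h e).1 le_rfl) ((h _).2 le_rfl)]

lemma AlmostDedekind.nu_eq_of_map_eq (hAD : AlmostDedekind R) (M : MaximalSpectrum R)
    {I : Ideal R} (hI : I ≠ ⊥) {n : ℕ}
    (h : I.map (algebraMap R (Localization.AtPrime M.asIdeal)) =
      IsLocalRing.maximalIdeal (Localization.AtPrime M.asIdeal) ^ n) : nu R I M = n := by
  rw [hAD.map_eq_pow_nu M hI] at h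
  exact le_antisymm (hAD.maximalIdeal_pow_le_iff M |>.1 h.ge)
    (hAD.maximalIdeal_pow_le_iff M |>.1 h.le)

lemma AlmostDedekind.nu_mul (hAD : AlmostDedekind R) (M : MaximalSpectrum R)
    {I J : Ideal R} (hI : I ≠ ⊥) (hJ : J ≠ ⊥) : nu R (I * J) M = nu R I M + nu R J M := by
  refine hAD.nu_eq_of_map_eq M (mul_ne_zero hI hJ) ?_
  rw [Ideal.map_mul, hAD.map_eq_pow_nu M hI, hAD.map_eq_pow_nu M hJ, pow_add]

lemma AlmostDedekind.nu_pow (hAD : AlmostDedekind R) (M : MaximalSpectrum R)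
    {I : Ideal R} (hI : I ≠ ⊥) (k : ℕ) : nu R (I ^ k) M = k * nu R I M := by
  refine hAD.nu_eq_of_map_eq M (pow_ne_zero k hI) ?_
  rw [Ideal.map_pow, hAD.map_eq_pow_nu M hI, ← pow_mul, mul_comm]

lemma AlmostDedekind.nu_sup (hAD : AlmostDedekind R) (M : MaximalSpectrum R)
    {I J : Ideal R} (hI : I ≠ ⊥) (hJ : J ≠ ⊥) :
    nu R (I ⊔ J) M = min (nu R I M) (nu R J M) := by
  have hIJ : I ⊔ J ≠ ⊥ := fun h => hI (sup_eq_bot_iff.1 h).1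
  refine eq_of_forall_le_iff fun n => ?_
  rw [le_min_iff, ← hAD.map_le_pow_iff M hIJ, ← hAD.map_le_pow_iff M hI,
    ← hAD.map_le_pow_iff M hJ, Ideal.map_sup, sup_le_iff]

lemma AlmostDedekind.one_le_nu_iff (hAD : AlmostDedekind R) (M : MaximalSpectrum R)
    {I : Ideal R} (hI : I ≠ ⊥) : 1 ≤ nu R I M ↔ I ≤ M.asIdeal := by
  rw [← hAD.map_le_pow_iff M hI, pow_one, Ideal.map_le_iff_le_comap, ← Ideal.under_def,
    IsLocalization.AtPrime.under_maximalIdeal _ M.asIdeal]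

lemma AlmostDedekind.asIdeal_ne_bot (hAD : AlmostDedekind R) (M : MaximalSpectrum R) :
    M.asIdeal ≠ ⊥ := by
  intro h
  have := hAD M
  apply IsDiscreteValuationRing.not_a_field (Localization.AtPrime M.asIdeal)
  rw [← Localization.AtPrime.map_eq_maximalIdeal]
  exact (congrArg _ h).trans Ideal.map_bot

lemma AlmostDedekind.exists_elemVal_eq_one (hAD : AlmostDedekind R) (M : MaximalSpectrum R) :
    ∃ p ∈ M.asIdeal, p ≠ 0 ∧ elemVal R M p = 1 := by
  have h1 : nu R M.asIdeal M = 1 := hAD.nu_eq_of_map_eq M (hAD.asIdeal_ne_bot M) (by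
    rw [pow_one, Localization.AtPrime.map_eq_maximalIdeal])
  simpa [h1] using exists_elemVal_eq_nu (hAD.asIdeal_ne_bot M) M

/-- A nonzero ideal of an almost Dedekind domain is radical if and only if it is `1`-bounded. -/
lemma AlmostDedekind.isRadical_iff_nu_le_one (hAD : AlmostDedekind R) {I : Ideal R}
    (hI : I ≠ ⊥) : I.IsRadical ↔ ∀ M, nu R I M ≤ 1 := by
  constructor
  · intro hrad M
    obtain ⟨p, -, hp0, hp1⟩ := hAD.exists_elemVal_eq_one M
    have hpow : algebraMap R (Localization.AtPrime M.asIdeal) (p ^ nu R I M) ∈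
        I.map (algebraMap R (Localization.AtPrime M.asIdeal)) := by
      rw [hAD.map_eq_pow_nu M hI, map_pow]
      refine Ideal.pow_mem_pow ?_ _
      simpa using (hAD.algebraMap_mem_pow_iff M hp0 1).2 hp1.ge
    obtain ⟨s, hs, hsp⟩ := (IsLocalization.algebraMap_mem_map_algebraMap_iff
      M.asIdeal.primeCompl _ _ _).1 hpow
    have hspI : s * p ∈ I := by
      refine hrad ⟨nu R I M + 1, ?_⟩
      have : (s * p) ^ (nu R I M + 1) = s ^ nu R I M * p * (s * p ^ nu R I M) := by ring
      exact this ▸ I.mul_mem_left _ hsp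
    have hmem := (IsLocalization.algebraMap_mem_map_algebraMap_iff M.asIdeal.primeCompl
      (Localization.AtPrime M.asIdeal) _ _).2 ⟨s, hs, hspI⟩
    rw [hAD.map_eq_pow_nu M hI, hAD.algebraMap_mem_pow_iff M hp0, hp1] at hmem
    exact hmem
  · rintro h x ⟨k, hk⟩
    suffices htop : Submodule.comap (LinearMap.toSpanSingleton R R x) I = ⊤ by
      simpa using (Ideal.eq_top_iff_one _).1 htop
    by_contra hne
    obtain ⟨P, hP, hle⟩ := Ideal.exists_le_maximal _ hne
    let M : MaximalSpectrum R := ⟨P, hP⟩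
    have hx : algebraMap R (Localization.AtPrime M.asIdeal) x ∈
        I.map (algebraMap R (Localization.AtPrime M.asIdeal)) := by
      have hk' := Ideal.mem_map_of_mem (algebraMap R (Localization.AtPrime M.asIdeal)) hk
      rw [hAD.map_eq_pow_nu M hI] at hk' ⊢
      rcases Nat.le_one_iff_eq_zero_or_eq_one.1 (h M) with h0 | h1
      · simp [h0]
      · rw [h1, pow_one] at hk' ⊢
        rw [map_pow] at hk'
        exact Ideal.IsPrime.mem_of_pow_mem inferInstance _ hk'
    obtain ⟨s, hs, hsx⟩ := (IsLocalization.algebraMap_mem_map_algebraMap_iff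
      M.asIdeal.primeCompl _ _ _).1 hx
    exact hs (hle (by simpa using hsx))

/-- Finitely generated ideals of an almost Dedekind domain are locally principal. -/
lemma AlmostDedekind.exists_dvd_mul (hAD : AlmostDedekind R) (M : MaximalSpectrum R)
    {K : Ideal R} (hK : K ≠ ⊥) (hfg : K.FG) :
    ∃ s ∉ M.asIdeal, ∃ k ∈ K, k ≠ 0 ∧ ∀ g ∈ K, k ∣ s * g := by
  obtain ⟨k, hkK, hk0, hkv⟩ := exists_elemVal_eq_nu hK M
  have hspan : Ideal.span {k} ≠ ⊥ := by simpa using hk0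
  have hloc : ∀ g ∈ K, ∃ s ∉ M.asIdeal, k ∣ s * g := by
    intro g hg
    have hle : nu R (Ideal.span {k}) M ≤ nu R K M :=
      hkv ▸ nu_le_elemVal (Ideal.mem_span_singleton_self k) hk0 M
    have hg' := Ideal.mem_map_of_mem (algebraMap R (Localization.AtPrime M.asIdeal)) hg
    rw [hAD.map_eq_pow_nu M hK] at hg'
    replace hg' := Ideal.pow_le_pow_right hle hg'
    rw [← hAD.map_eq_pow_nu M hspan,
      IsLocalization.algebraMap_mem_map_algebraMap_iff M.asIdeal.primeCompl] at hg'
    obtain ⟨s, hs, hsg⟩ := hg'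
    exact ⟨s, hs, Ideal.mem_span_singleton.1 hsg⟩
  obtain ⟨T, rfl⟩ := hfg
  choose! s hs hdvd using hloc
  refine ⟨∏ t ∈ T, s t, ?_, k, hkK, hk0, ?_⟩
  · rw [Ideal.IsPrime.prod_mem_iff]
    rintro ⟨t, ht, hst⟩
    exact hs t (Ideal.subset_span ht) hst
  · intro g hg
    have hle : Ideal.span (T : Set R) ≤
        Submodule.comap (LinearMap.mulLeft R (∏ t ∈ T, s t)) (Ideal.span {k}) := by
      refine Ideal.span_le.2 fun t ht => ?_
      simp only [Submodule.comap_coe, Set.mem_preimage, LinearMap.mulLeft_apply, SetLike.mem_coe,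
        Ideal.mem_span_singleton]
      exact (hdvd t (Ideal.subset_span ht)).trans
        (mul_dvd_mul_right (Finset.dvd_prod_of_mem s ht) t)
    simpa [Ideal.mem_span_singleton] using hle hg

/-- In an almost Dedekind domain, containment of finitely generated ideals is divisibility, with
a finitely generated cofactor. -/
lemma AlmostDedekind.exists_fg_mul_eq (hAD : AlmostDedekind R) {I K : Ideal R} (hK : K ≠ ⊥)
    (hIfg : I.FG) (hKfg : K.FG) (hIK : I ≤ K) : ∃ H : Ideal R, H.FG ∧ H * K = I := by
  let A : Set R := {s | ∃ k ∈ K, k ≠ 0 ∧ ∀ g ∈ K, k ∣ s * g}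
  have hA : Ideal.span A = ⊤ := by
    by_contra hne
    obtain ⟨P, hP, hle⟩ := Ideal.exists_le_maximal _ hne
    obtain ⟨s, hs, hsA⟩ := hAD.exists_dvd_mul ⟨P, hP⟩ hK hKfg
    exact hs (hle (Ideal.subset_span hsA))
  obtain ⟨T, hTA, hT⟩ := (Ideal.span_eq_top_iff_finite A).1 hA
  have hquot : ∀ s : T, ∃ k ∈ K, k ≠ 0 ∧ (∀ g ∈ K, k ∣ s * g) ∧
      ∃ φ : I →ₗ[R] R, ∀ g : I, k * φ g = s * g := by
    intro s
    obtain ⟨k, hkK, hk0, hdvd⟩ := hTA s.2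
    choose c hc using fun g : I => hdvd g (hIK g.2)
    refine ⟨k, hkK, hk0, hdvd, ⟨⟨c, fun x y => ?_⟩, fun r x => ?_⟩, fun g => (hc g).symm⟩
    · apply mul_left_cancel₀ hk0
      rw [← hc, mul_add, ← hc, ← hc, Submodule.coe_add, mul_add]
    · apply mul_left_cancel₀ hk0
      simp only [RingHom.id_apply, smul_eq_mul]
      rw [← hc, mul_left_comm, ← hc, Submodule.coe_smul, smul_eq_mul, mul_left_comm]
  choose k hkK hk0 hdvd φ hφ using hquot
  have : Module.Finite R I := Module.Finite.of_fg hIfg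
  refine ⟨⨆ s, LinearMap.range (φ s), Submodule.fg_iSup _ fun s => by
    rw [LinearMap.range_eq_map]
    exact Module.Finite.fg_top.map _, le_antisymm ?_ fun g hg => ?_⟩
  · rw [Ideal.iSup_mul]
    refine iSup_le fun s => Ideal.mul_le.2 ?_
    rintro _ ⟨g, rfl⟩ x hx
    obtain ⟨u, hu⟩ := hdvd s x hx
    have : φ s g * x = u * g := by
      apply mul_left_cancel₀ (hk0 s)
      linear_combination x * hφ s g + (g : R) * hu
    exact this ▸ I.mul_mem_left u g.2
  · suffices htop : (⊤ : Ideal R) ≤ Submodule.comap (LinearMap.toSpanSingleton R R g)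
        ((⨆ s, LinearMap.range (φ s) : Ideal R) * K) by
      simpa using htop (Submodule.mem_top (x := (1 : R)))
    rw [← hT, Ideal.span_le]
    intro s hs
    have hmem := Ideal.mul_mem_mul
      ((le_iSup (fun s => LinearMap.range (φ s)) ⟨s, hs⟩) ⟨⟨g, hg⟩, rfl⟩) (hkK ⟨s, hs⟩)
    rw [mul_comm (φ _ _), hφ] at hmem
    simpa using hmem

/-- A proper nonzero finitely generated bounded ideal gives rise to a proper nonzero finitely
generated radical ideal. -/
lemma AlmostDedekind.exists_isRadical_of_bounded (hAD : AlmostDedekind R) {I : Ideal R}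
    (hfg : I.FG) (hI : I ≠ ⊥) (htop : I ≠ ⊤) {b : ℕ} (hb : ∀ M, nu R I M ≤ b) :
    ∃ (H : Ideal R) (M : MaximalSpectrum R), H ≠ ⊥ ∧ H.FG ∧ H.IsRadical ∧ H ≤ M.asIdeal := by
  obtain ⟨P, hP, hIP⟩ := Ideal.exists_le_maximal I htop
  have hbdd : BddAbove (Set.range (nu R I)) := ⟨b, by rintro _ ⟨M, rfl⟩; exact hb M⟩
  obtain ⟨M₀, hM₀⟩ := Nat.sSup_mem ⟨_, Set.mem_range_self ⟨P, hP⟩⟩ hbdd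
  have hmax : ∀ M, nu R I M ≤ nu R I M₀ := fun M => hM₀ ▸ le_csSup hbdd ⟨M, rfl⟩
  have hpos : 1 ≤ nu R I M₀ := ((hAD.one_le_nu_iff ⟨P, hP⟩ hI).2 hIP).trans (hmax _)
  obtain ⟨n, hn⟩ := Nat.exists_eq_add_of_le' hpos
  obtain ⟨p, hpM, hp0, hp1⟩ := hAD.exists_elemVal_eq_one M₀
  set J := I ⊔ Ideal.span {p}
  have hJ : J ≠ ⊥ := ne_bot_of_le_ne_bot hI le_sup_left
  have hJfg : J.FG := Submodule.FG.sup hfg (Submodule.fg_span_singleton p)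
  have hJM₀ : nu R J M₀ = 1 := by
    refine le_antisymm (hp1 ▸ nu_le_elemVal
      (le_sup_right (a := I) (Ideal.mem_span_singleton_self p)) hp0 M₀) ?_
    rw [hAD.one_le_nu_iff M₀ hJ]
    exact sup_le ((hAD.one_le_nu_iff M₀ hI).1 hpos) (by simpa [Ideal.span_le] using hpM)
  set I' := I ⊔ J ^ (n + 1)
  set K := I' ⊔ J ^ n
  have hI' : I' ≠ ⊥ := ne_bot_of_le_ne_bot hI le_sup_left
  have hK : K ≠ ⊥ := ne_bot_of_le_ne_bot hI' le_sup_left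
  have hI'fg : I'.FG := Submodule.FG.sup hfg hJfg.pow
  obtain ⟨H, hHfg, hHK⟩ := hAD.exists_fg_mul_eq hK hI'fg (Submodule.FG.sup hI'fg hJfg.pow) le_sup_left
  have hH : H ≠ ⊥ := by
    rintro rfl
    exact hI' (by rw [← hHK, Ideal.bot_mul])
  have hnu : ∀ M, nu R H M + min (min (nu R I M) ((n + 1) * nu R J M)) (n * nu R J M) =
      min (nu R I M) ((n + 1) * nu R J M) := by
    intro M
    have hI'M : nu R I' M = min (nu R I M) ((n + 1) * nu R J M) := by
      rw [hAD.nu_sup M hI (pow_ne_zero _ hJ), hAD.nu_pow M hJ]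
    rw [← hI'M, ← hAD.nu_pow M hJ, ← hAD.nu_sup M hI' (pow_ne_zero _ hJ), ← hAD.nu_mul M hH hK,
      hHK]
  refine ⟨H, M₀, hH, hHfg, (hAD.isRadical_iff_nu_le_one hH).2 fun M => ?_,
    (hAD.one_le_nu_iff M₀ hH).1 ?_⟩
  · have h := hnu M
    have hle := hmax M
    rcases Nat.eq_zero_or_pos (nu R J M) with h0 | h0
    · simp [h0] at h
      omega
    · have : n ≤ n * nu R J M := Nat.le_mul_of_pos_right n h0
      omega
  · have h := hnu M₀
    simp only [hJM₀, hn] at h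
    omega

end Valuation

/-- For an almost Dedekind domain `D`, the following are equivalent:
(i) `Crit(D) = Max(D)`; (ii) `Critⁿ(D) = Max(D)` for some `n ∈ ℕ` (`n ≥ 1`);
(iii) `Critⁿ(D) = Max(D)` for all `n ∈ ℕ` (`n ≥ 1`); (iv) `Critʷ(D) = Max(D)`;
(v) no nonzero proper finitely generated ideal of `D` is bounded. -/
theorem statement7 (R : Type*) [CommRing R] [IsDomain R] (hR : ¬ IsField R)
    (hAD : AlmostDedekind R) :
    List.TFAE
      [Crit R = Set.univ,
       ∃ n : ℕ, 1 ≤ n ∧ CritN R n = Set.univ,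
       ∀ n : ℕ, 1 ≤ n → CritN R n = Set.univ,
       CritOmega R = Set.univ,
       ∀ I : Ideal R, I.FG → I ≠ ⊥ → I ≠ ⊤ → ¬ ∃ b : ℕ, ∀ M, nu R I M ≤ b] := by
  tfae_have 1 → 5 := by
    rintro h I hfg hI htop ⟨b, hb⟩
    obtain ⟨H, M, hH, hHfg, hrad, hle⟩ := hAD.exists_isRadical_of_bounded hfg hI htop hb
    exact (h.ge (Set.mem_univ M)) H hH hHfg hrad hle
  tfae_have 5 → 4 := by
    intro h
    refine Set.eq_univ_of_forall fun M J hJ hfg hb hle => ?_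
    exact h J hfg hJ (fun htop => M.isMaximal.ne_top (top_le_iff.1 (htop ▸ hle))) hb
  tfae_have 4 → 3 := by
    intro h n _
    exact Set.eq_univ_of_forall fun M J hJ hfg hb => h.ge (Set.mem_univ M) J hJ hfg ⟨n, hb⟩
  tfae_have 3 → 2 := fun h => ⟨1, le_rfl, h 1 le_rfl⟩
  tfae_have 2 → 1 := by
    rintro ⟨n, hn, h⟩
    exact Set.eq_univ_of_forall fun M J hJ hfg hrad => h.ge (Set.mem_univ M) J hJ hfg
      fun N => ((hAD.isRadical_iff_nu_le_one hJ).1 hrad N).trans hn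
  tfae_finish

end ADPaper
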